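/- Let $p$ be a prime, $V$ an abelian group, and $d, t$ positive integers with $p^t > d$. Then every polynomial function $f : V \to \mathbb{F}_p$ of degree at most $d$ factors through the projection $V \to V/p^tV$; that is, the inclusion $\mathrm{Pol}_d(V/p^tV, \mathbb{F}_p) \hookrightarrow \mathrm{Pol}_d(V, \mathbb{F}_p)$ induced by the projection is an equality. -/

import Mathlib

/-- A function `f : V → W` between abelian groups is polynomial of degree at most `d` if its
`(d+1)`-st cross effect vanishes. -/
def IsPolynomialDeg {V W : Type*} [AddCommGroup V] [AddCommGroup W] (d : ℕ) (f : V → W) : Prop :=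
  ∀ v : Fin (d + 1) → V,
    ∑ S : Finset (Fin (d + 1)), (-1 : ℤ) ^ S.card • f (∑ i ∈ S, v i) = 0

/-- The subgroup `p^t V` of `V`, as a `ℤ`-submodule. -/
def pPowSub (V : Type*) [AddCommGroup V] (p t : ℕ) : Submodule ℤ V :=
  LinearMap.range (((p : ℤ) ^ t) • (LinearMap.id : V →ₗ[ℤ] V))

open Finset in
/-- An alternating sum over subsets depending only on cardinality is an iterated difference. -/
lemma sum_powerset_neg_one_pow_smul_eq_fwdDiff_iter {ι V W : Type*} [AddCommGroup V]
    [AddCommGroup W] (f : V → W) (s : Finset ι) (y h : V) :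
    ∑ S ∈ s.powerset, (-1 : ℤ) ^ #S • f (y + #S • h) =
      (-1 : ℤ) ^ #s • (fwdDiff h)^[#s] f y := by
  rw [sum_powerset_apply_card (fun m => (-1 : ℤ) ^ m • f (y + m • h)),
    fwdDiff_iter_eq_sum_shift, smul_sum]
  refine sum_congr rfl fun k hk => ?_
  obtain ⟨m, hm⟩ := Nat.exists_eq_add_of_le (Nat.lt_succ_iff.mp (mem_range.mp hk))
  have hsq : (-1 : ℤ) ^ m * (-1) ^ m = 1 := by rw [← mul_pow]; simp
  rw [hm, Nat.add_sub_cancel_left, ← natCast_zsmul, smul_smul, smul_smul]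
  congr 1
  rw [pow_add]
  linear_combination (-(-1 : ℤ) ^ k * ((k + m).choose k : ℤ)) * hsq

open Finset in
/-- The `d`-fold difference of a polynomial function of degree at most `d` is constant. -/
lemma IsPolynomialDeg.fwdDiff_iter_eq {V W : Type*} [AddCommGroup V] [AddCommGroup W] {d : ℕ}
    {f : V → W} (hf : IsPolynomialDeg d f) (h w : V) :
    (fwdDiff h)^[d] f w = (fwdDiff h)^[d] f 0 := by
  classical
  set s : Finset (Fin (d + 1)) := univ.erase 0 with hs
  have h0 : (0 : Fin (d + 1)) ∉ s := notMem_erase _ _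
  have hcard : #s = d := by simp [hs]
  have key := hf (Function.update (fun _ => h) 0 w)
  have hsum : ∀ S ∈ s.powerset,
      ∑ i ∈ S, Function.update (fun _ : Fin (d + 1) => h) 0 w i = #S • h := by
    intro S hS
    rw [sum_update_of_notMem fun hm => h0 (mem_powerset.mp hS hm), sum_const]
  rw [← powerset_univ, ← insert_erase (mem_univ (0 : Fin (d + 1))), ← hs,
    sum_powerset_insert h0] at key
  have hfst : ∑ S ∈ s.powerset, (-1 : ℤ) ^ #S •
      f (∑ i ∈ S, Function.update (fun _ : Fin (d + 1) => h) 0 w i) =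
      (-1 : ℤ) ^ d • (fwdDiff h)^[d] f 0 := by
    have := sum_powerset_neg_one_pow_smul_eq_fwdDiff_iter f s 0 h
    rw [hcard] at this
    rw [← this]
    exact sum_congr rfl fun S hS => by rw [hsum S hS, zero_add]
  have hsnd : ∑ S ∈ s.powerset, (-1 : ℤ) ^ #(insert 0 S) •
      f (∑ i ∈ insert 0 S, Function.update (fun _ : Fin (d + 1) => h) 0 w i) =
      -((-1 : ℤ) ^ d • (fwdDiff h)^[d] f w) := by
    have := sum_powerset_neg_one_pow_smul_eq_fwdDiff_iter f s w h
    rw [hcard] at this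
    rw [← this, ← sum_neg_distrib]
    refine sum_congr rfl fun S hS => ?_
    have hS0 : (0 : Fin (d + 1)) ∉ S := fun hm => h0 (mem_powerset.mp hS hm)
    rw [sum_insert hS0, hsum S hS, card_insert_of_notMem hS0, Function.update_self, pow_succ,
      mul_neg_one, neg_smul]
  rw [hfst, hsnd, ← sub_eq_add_neg, ← smul_sub] at key
  have := congrArg (fun x => (-1 : ℤ) ^ d • x) key
  simp only [smul_smul, ← mul_pow, neg_mul_neg, one_mul, one_pow, one_smul, smul_zero] at this
  exact (sub_eq_zero.mp this).symm

/-- Iterated differences of order exceeding the degree of a polynomial function vanish. -/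
lemma IsPolynomialDeg.fwdDiff_iter_eq_zero {V W : Type*} [AddCommGroup V] [AddCommGroup W]
    {d n : ℕ} {f : V → W} (hf : IsPolynomialDeg d f) (hn : d < n) (h : V) :
    (fwdDiff h)^[n] f = 0 := by
  have hconst : (fwdDiff h)^[d] f = fun _ => (fwdDiff h)^[d] f 0 :=
    funext fun w => hf.fwdDiff_iter_eq h w
  obtain ⟨m, rfl⟩ := Nat.exists_eq_add_of_lt hn
  rw [show d + m + 1 = m + (d + 1) by ring, Function.iterate_add_apply,
    Function.iterate_succ_apply', hconst, fwdDiff_const]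
  exact Function.iterate_fixed (fwdDiff_const h (0 : W)) m

/-- A polynomial function of degree less than `p ^ t` with values in `ZMod p` is invariant under
translation by multiples of `p ^ t`. -/
lemma IsPolynomialDeg.apply_add_pow_nsmul {V : Type*} [AddCommGroup V] {p d t : ℕ}
    [Fact p.Prime] {f : V → ZMod p} (hf : IsPolynomialDeg d f) (h : d < p ^ t) (x v : V) :
    f (x + p ^ t • v) = f x := by
  rw [shift_eq_sum_fwdDiff_iter v f, Finset.sum_eq_single 0]
  · simp
  · intro k hk hk0
    rcases (Nat.lt_succ_iff.mp (Finset.mem_range.mp hk)).eq_or_lt with rfl | hlt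
    · simp [hf.fwdDiff_iter_eq_zero h v]
    · have hdvd : p ∣ (p ^ t).choose k :=
        (Fact.out : p.Prime).dvd_choose_pow hk0 hlt.ne
      rw [nsmul_eq_mul, (ZMod.natCast_eq_zero_iff _ _).mpr hdvd, zero_mul]
  · simp

/-- for `p^t > d`, precomposition with the projection `V → V/p^tV` is a bijection
between polynomial functions of degree at most `d` on `V/p^tV` and on `V`. -/
theorem stmt5 (p d t : ℕ) [Fact p.Prime] (hd : 0 < d) (ht : 0 < t) (h : d < p ^ t)
    (V : Type*) [AddCommGroup V] :
    Function.Bijective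
      (fun g : {g : (V ⧸ pPowSub V p t) → ZMod p // IsPolynomialDeg d g} =>
        (⟨fun v => g.1 ((pPowSub V p t).mkQ v), by
            intro v
            simpa [map_sum] using g.2 (fun i => (pPowSub V p t).mkQ (v i))⟩ :
          {f : V → ZMod p // IsPolynomialDeg d f})) := by
  constructor
  · intro g₁ g₂ hg
    refine Subtype.ext (funext fun x => ?_)
    obtain ⟨v, rfl⟩ := (pPowSub V p t).mkQ_surjective x
    exact congrFun (congrArg Subtype.val hg) v
  · rintro ⟨f, hf⟩
    have hfac : ∀ a b : V, (pPowSub V p t).mkQ a = (pPowSub V p t).mkQ b → f a = f b := by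
      intro a b hab
      obtain ⟨w, hw⟩ := (Submodule.Quotient.eq _).mp hab
      have hw' : p ^ t • w = a - b := by
        rw [← hw, ← natCast_zsmul, Nat.cast_pow, LinearMap.smul_apply, LinearMap.id_apply]
      rw [← hf.apply_add_pow_nsmul h b w, hw', add_sub_cancel]
    have hsurj := (pPowSub V p t).mkQ_surjective
    have hval : ∀ v : V, f (Function.surjInv hsurj ((pPowSub V p t).mkQ v)) = f v :=
      fun v => hfac _ _ (Function.surjInv_eq hsurj _)
    refine ⟨⟨fun x => f (Function.surjInv hsurj x), fun x => ?_⟩,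
      Subtype.ext (funext hval)⟩
    choose v hv using fun i => hsurj (x i)
    simp_rw [← hv, ← map_sum, hval]
    exact hf v
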